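/- Let H be an elementary abelian 2-hypergroup and r ∈ H. Then r^{2s+2} = {a ∈ H : a ⪯ r⁺} for every s ∈ ℕ₀. Moreover, if r ∈ Thick(H), then r = r⁺, the closed subset ⟨r⟩ generated by r equals {a ∈ H : a ⪯ r}, and |⟨r⟩| = 2^{s(r)}. -/

import Mathlib

namespace HyperPaper

/-- A hypergroup: hypermultiplication `hmul`, inversion `star`, identity `e`,
satisfying (H1) associativity, (H2) unique two-sided identity, (H3) exchange conditions. -/
structure Hypergroup (H : Type*) where
  hmul : H → H → Set H
  star : H → H
  e : H
  idl : ∀ p, hmul e p = {p}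
  idr : ∀ p, hmul p e = {p}
  e_unique : ∀ e' : H, (∀ p, hmul e' p = {p} ∧ hmul p e' = {p}) → e' = e
  assoc : ∀ p q r : H, (⋃ x ∈ hmul p q, hmul x r) = ⋃ x ∈ hmul q r, hmul p x
  h3l : ∀ p q r : H, p ∈ hmul q r ↔ q ∈ hmul p (star r)
  h3r : ∀ p q r : H, p ∈ hmul q r ↔ r ∈ hmul (star q) p

variable {H : Type*}

namespace Hypergroup

/-- Product of two subsets: FG = {a : ∃ b ∈ F, c ∈ G, a ∈ bc}. -/
def smul (hg : Hypergroup H) (F G : Set H) : Set H :=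
  {a | ∃ b ∈ F, ∃ c ∈ G, a ∈ hg.hmul b c}

/-- Closed subset: nonempty and G*G ⊆ G. -/
def IsClosed (hg : Hypergroup H) (G : Set H) : Prop :=
  G.Nonempty ∧ hg.smul (hg.star '' G) G ⊆ G

/-- Thin element: p*p = {e}. -/
def IsThin (hg : Hypergroup H) (p : H) : Prop := hg.hmul (hg.star p) p = {hg.e}

/-- Thick element: not thin. -/
def IsThick (hg : Hypergroup H) (p : H) : Prop := ¬ hg.IsThin p

/-- Involution: p ≠ e and {e, p} is closed. -/
def IsInvolution (hg : Hypergroup H) (p : H) : Prop :=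
  p ≠ hg.e ∧ hg.IsClosed {hg.e, p}

/-- ⟨G⟩: smallest closed subset containing G. -/
def gen (hg : Hypergroup H) (G : Set H) : Set H := ⋂₀ {C | hg.IsClosed C ∧ G ⊆ C}

/-- O_ϑ(G): the thin elements of H lying in G. -/
def Othin (hg : Hypergroup H) (G : Set H) : Set H := {p ∈ G | hg.IsThin p}

/-- F is a strongly normal closed subset of G: p*Fp ⊆ F ⊆ G for all p ∈ G. -/
def IsStronglyNormal (hg : Hypergroup H) (F G : Set H) : Prop :=
  hg.IsClosed F ∧ hg.IsClosed G ∧ F ⊆ G ∧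
    ∀ p ∈ G, hg.smul (hg.smul {hg.star p} F) {p} ⊆ F

/-- O^ϑ(G): intersection of all strongly normal closed subsets of ⟨G⟩. -/
def Osup (hg : Hypergroup H) (G : Set H) : Set H :=
  ⋂₀ {F | hg.IsStronglyNormal F (hg.gen G)}

/-- F is a normal closed subset of G. -/
def IsNormal (hg : Hypergroup H) (F G : Set H) : Prop :=
  hg.IsClosed F ∧ hg.IsClosed G ∧ F ⊆ G ∧ ∀ p ∈ G, hg.smul F {p} = hg.smul {p} F

/-- Product of a list of subsets (empty product is {e}). -/
def listProd (hg : Hypergroup H) : List (Set H) → Set H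
  | [] => {hg.e}
  | a :: l => hg.smul a (hg.listProd l)

/-- Product r_1 r_2 ⋯ r_n of a family of elements. -/
def famProd (hg : Hypergroup H) {n : ℕ} (r : Fin n → H) : Set H :=
  hg.listProd ((List.finRange n).map fun i => ({r i} : Set H))

/-- Ĝ_i: the product of the G_j with j ≠ i. -/
def cofactor (hg : Hypergroup H) {n : ℕ} (G : Fin n → Set H) (i : Fin n) : Set H :=
  hg.listProd (((List.finRange n).filter fun j => decide (j ≠ i)).map G)

/-- H is the direct product of the normal closed subsets G_1, …, G_n. -/
def IsDirectProduct (hg : Hypergroup H) {n : ℕ} (G : Fin n → Set H) : Prop :=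
  (∀ i, hg.IsNormal (G i) Set.univ) ∧
  (∀ i, hg.smul (G i) (hg.cofactor G i) = Set.univ) ∧
  (∀ i, G i ∩ hg.cofactor G i = {hg.e})

/-- r : Fin n → H is a decomposition of x with respect to the family G. -/
def IsDecomp (hg : Hypergroup H) {n : ℕ} (G : Fin n → Set H) (x : H) (r : Fin n → H) : Prop :=
  (∀ i, r i ∈ G i) ∧ x ∈ hg.famProd r

/-- The support of x: the elements ≠ e appearing in the decomposition of x. -/
def dsupport (hg : Hypergroup H) {n : ℕ} (G : Fin n → Set H) (x : H) : Set H :=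
  {y | y ≠ hg.e ∧ ∃ r, hg.IsDecomp G x r ∧ y ∈ Set.range r}

/-- The cover of x: the product r_1r_2⋯r_n for the decomposition of x. -/
def dcover (hg : Hypergroup H) {n : ℕ} (G : Fin n → Set H) (x : H) : Set H :=
  {y | ∃ r, hg.IsDecomp G x r ∧ y ∈ hg.famProd r}

/-- x is constrained: its cover equals {x}. -/
def IsConstrained (hg : Hypergroup H) {n : ℕ} (G : Fin n → Set H) (x : H) : Prop :=
  hg.dcover G x = {x}

/-- r_2(G): the largest 2-rank of a thin closed subset of H contained in G
(equivalently, the largest k such that G contains a thin symmetric closed subset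
of 2^k elements, which corresponds to an elementary abelian 2-group of 2-rank k). -/
noncomputable def rank2 (hg : Hypergroup H) (G : Set H) : ℕ :=
  sSup {k | ∃ U : Set H, hg.IsClosed U ∧ U ⊆ G ∧ (∀ u ∈ U, hg.IsThin u) ∧
    (∀ u ∈ U, hg.star u = u) ∧ U.ncard = 2 ^ k}

/-- F is a minimal generating subset of G. -/
def IsMinGen (hg : Hypergroup H) (G F : Set H) : Prop :=
  F ⊆ G ∧ hg.gen F = G ∧ ∀ p ∈ F, hg.gen (F \ {p}) ≠ G

/-- The dimension of G: the smallest cardinality of a minimal generating subset. -/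
noncomputable def dimension (hg : Hypergroup H) (G : Set H) : ℕ :=
  sInf {k | ∃ F : Set H, hg.IsMinGen G F ∧ F.Finite ∧ F.ncard = k}

/-- [F, G] = ⟨{a : ∃ b ∈ F, c ∈ G, a ∈ b*c*bc}⟩. -/
def commSet (hg : Hypergroup H) (F G : Set H) : Set H :=
  hg.gen {a | ∃ b ∈ F, ∃ c ∈ G,
    a ∈ hg.smul (hg.smul (hg.smul {hg.star b} {hg.star c}) {b}) {c}}

/-- derived G k = G^{(k+1)}: G^{(1)} = G, G^{(r)} = [G^{(r-1)}, G]. -/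
def derived (hg : Hypergroup H) (G : Set H) : ℕ → Set H
  | 0 => G
  | k + 1 => hg.commSet (hg.derived G k) G

/-- G is nilpotent: G^{(r)} = {e} for some r. -/
def IsNilpotent (hg : Hypergroup H) (G : Set H) : Prop :=
  ∃ k : ℕ, hg.derived G k = {hg.e}

/-- G is a residually thin closed subset: there is a chain {e} = F_1, …, F_n = G of
pairwise distinct closed subsets, each strongly normal in the next. -/
def IsResiduallyThin (hg : Hypergroup H) (G : Set H) : Prop :=
  ∃ (m : ℕ) (F : Fin (m + 1) → Set H), Function.Injective F ∧
    F 0 = {hg.e} ∧ F (Fin.last m) = G ∧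
    ∀ i : Fin m, hg.IsStronglyNormal (F i.castSucc) (F i.succ)

/-- x^k as a subset: x^0 = {e}, x^{k+1} = x^k · x. -/
def spow (hg : Hypergroup H) (x : H) : ℕ → Set H
  | 0 => {hg.e}
  | k + 1 => hg.smul (hg.spow x k) {x}

/-- F is a maximal closed subset of G. -/
def IsMaximalClosed (hg : Hypergroup H) (F G : Set H) : Prop :=
  hg.IsClosed F ∧ hg.IsClosed G ∧ F ⊆ G ∧ F ≠ G ∧
    ∀ E : Set H, hg.IsClosed E → F ⊆ E → E ⊆ G → E = F ∨ E = G

/-- The Frattini closed subset of G: the intersection (inside G) of all maximal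
closed subsets of G. -/
def frattini (hg : Hypergroup H) (G : Set H) : Set H :=
  G ∩ ⋂₀ {F | hg.IsMaximalClosed F G}

/-- α is an isomorphism from the closed subset F to the closed subset G. -/
def IsIso (hg : Hypergroup H) (F G : Set H) (α : H → H) : Prop :=
  Set.BijOn α F G ∧ α hg.e = hg.e ∧
    ∀ p ∈ F, ∀ q ∈ F, α '' hg.hmul p q = hg.hmul (α p) (α q)

/-- F ≃ G: there is an isomorphism from F to G. -/
def Isomorphic (hg : Hypergroup H) (F G : Set H) : Prop := ∃ α : H → H, hg.IsIso F G α

/-- Aut(G): the automorphism group of G, realized as the subgroup of permutations of G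
that fix e and preserve the hypermultiplication. -/
def autGroup (hg : Hypergroup H) (G : Set H) : Subgroup (Equiv.Perm G) where
  carrier := {σ | (∀ x : G, (x : H) = hg.e → ((σ x : H)) = hg.e) ∧
    ∀ p q x : G, (x : H) ∈ hg.hmul p q ↔ ((σ x : H)) ∈ hg.hmul (σ p) (σ q)}
  one_mem' := by
    constructor
    · intro x hx; simpa using hx
    · intro p q x; simp
  mul_mem' := by
    rintro σ τ ⟨he1, hm1⟩ ⟨he2, hm2⟩
    refine ⟨fun x hx => ?_, fun p q x => ?_⟩
    · simpa using he1 _ (he2 x hx)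
    · simpa using (hm2 p q x).trans (hm1 (τ p) (τ q) (τ x))
  inv_mem' := by
    rintro σ ⟨he, hm⟩
    refine ⟨fun x hx => ?_, fun p q x => ?_⟩
    · have h2 : σ x = x := Subtype.ext ((he x hx).trans hx.symm)
      have h3 : σ⁻¹ x = x := by
        conv_lhs => rw [← h2]
        simp
      rw [h3]; exact hx
    · have h := hm (σ⁻¹ p) (σ⁻¹ q) (σ⁻¹ x)
      simpa using h.symm

end Hypergroup

/-- An elementary abelian 2-hypergroup: a hypergroup that is the constrained direct
product of the closed subsets ⟨q_1⟩, …, ⟨q_n⟩ generated by involutions q_1, …, q_n. -/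
structure EA2Data (H : Type*) where
  hg : Hypergroup H
  n : ℕ
  q : Fin n → H
  invol : ∀ i, hg.IsInvolution (q i)
  dp : hg.IsDirectProduct fun i => hg.gen {q i}
  constrained : ∀ x : H, hg.IsConstrained (fun i => hg.gen {q i}) x

namespace EA2Data

/-- The family ⟨q_1⟩, …, ⟨q_n⟩. -/
def fam (E : EA2Data H) : Fin E.n → Set H := fun i => E.hg.gen {E.q i}

/-- The support of x. -/
def support (E : EA2Data H) (x : H) : Set H := E.hg.dsupport E.fam x

/-- Thick(F): externally thick elements of H lying in F. -/
def ThickIn (E : EA2Data H) (F : Set H) : Set H :=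
  {x ∈ F | x = E.hg.e ∨ ∀ y ∈ E.support x, E.hg.IsThick y}

/-- Thin(F): externally thin elements of H lying in F. -/
def ThinIn (E : EA2Data H) (F : Set H) : Set H :=
  {x ∈ F | x = E.hg.e ∨ ∀ y ∈ E.support x, E.hg.IsThin y}

/-- The (unique) pair (x⁺, x⁻) with x⁺ ∈ Thick(H), x⁻ ∈ Thin(H), x⁺x⁻ = {x}. -/
noncomputable def pm (E : EA2Data H) (x : H) : H × H :=
  @Classical.epsilon (H × H) ⟨(E.hg.e, E.hg.e)⟩ fun z =>
    z.1 ∈ E.ThickIn Set.univ ∧ z.2 ∈ E.ThinIn Set.univ ∧ E.hg.hmul z.1 z.2 = {x}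

/-- x⁺. -/
noncomputable def plus (E : EA2Data H) (x : H) : H := (E.pm x).1

/-- x⁻. -/
noncomputable def minus (E : EA2Data H) (x : H) : H := (E.pm x).2

/-- s(x): the number of thick elements of H in the support of x. -/
noncomputable def sElem (E : EA2Data H) (x : H) : ℕ :=
  {y ∈ E.support x | E.hg.IsThick y}.ncard

/-- s(G) = max {s(a) : a ∈ G}. -/
noncomputable def sSet (E : EA2Data H) (G : Set H) : ℕ :=
  sSup {k | ∃ a ∈ G, E.sElem a = k}

/-- x ⪯ y: the support of x is contained in the support of y. -/
def ple (E : EA2Data H) (x y : H) : Prop := E.support x ⊆ E.support y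

/-- p♯: the number of thick elements among q_1, …, q_n. -/
noncomputable def psharp (E : EA2Data H) : ℕ := {i : Fin E.n | E.hg.IsThick (E.q i)}.ncard

end EA2Data

/-- The Gaussian binomial coefficient C(n, k)_2 with base 2, via the
q-Pascal recurrence C(n, k)_2 = C(n-1, k-1)_2 + 2^k · C(n-1, k)_2. -/
def gaussBinom2 : ℕ → ℕ → ℕ
  | _, 0 => 1
  | 0, _ + 1 => 0
  | n + 1, k + 1 => gaussBinom2 n k + 2 ^ (k + 1) * gaussBinom2 n (k + 1)

end HyperPaper

namespace HyperPaper

variable {H : Type*}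

namespace Hypergroup

/-- The subsets of a hypergroup, as a monoid under the product of subsets. -/
def Sets (_hg : Hypergroup H) : Type _ := Set H

instance (hg : Hypergroup H) : Membership H hg.Sets := inferInstanceAs (Membership H (Set H))

/-- A subset as an element of the monoid of subsets. -/
def ofSet (hg : Hypergroup H) (A : Set H) : hg.Sets := A

/-- The singleton `{x}` as an element of the monoid of subsets. -/
def single (hg : Hypergroup H) (x : H) : hg.Sets := ({x} : Set H)

variable (hg : Hypergroup H)

theorem Sets.ext {hg : Hypergroup H} {A B : hg.Sets} (h : ∀ x, x ∈ A ↔ x ∈ B) : A = B :=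
  Set.ext h

theorem smul_assoc (A B C : Set H) :
    hg.smul (hg.smul A B) C = hg.smul A (hg.smul B C) := by
  have key : ∀ a b c x, (∃ y ∈ hg.hmul a b, x ∈ hg.hmul y c) ↔
      ∃ y ∈ hg.hmul b c, x ∈ hg.hmul a y := by
    intro a b c x
    have := Set.ext_iff.1 (hg.assoc a b c) x
    simpa using this
  ext x
  constructor
  · rintro ⟨y, ⟨a, ha, b, hb, hy⟩, c, hc, hx⟩
    obtain ⟨z, hz, hxz⟩ := (key a b c x).1 ⟨y, hy, hx⟩
    exact ⟨a, ha, z, ⟨b, hb, c, hc, hz⟩, hxz⟩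
  · rintro ⟨a, ha, z, ⟨b, hb, c, hc, hz⟩, hx⟩
    obtain ⟨y, hy, hxy⟩ := (key a b c x).2 ⟨z, hz, hx⟩
    exact ⟨y, ⟨a, ha, b, hb, hy⟩, c, hc, hxy⟩

instance : Monoid hg.Sets where
  mul A B := hg.smul A B
  one := hg.single hg.e
  mul_assoc := hg.smul_assoc
  one_mul A := Sets.ext fun x => by
    constructor
    · rintro ⟨b, rfl, c, hc, hx⟩
      rw [hg.idl] at hx
      exact (Set.mem_singleton_iff.1 hx) ▸ hc
    · intro hx
      exact ⟨hg.e, rfl, x, hx, by rw [hg.idl]; rfl⟩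
  mul_one A := Sets.ext fun x => by
    constructor
    · rintro ⟨b, hb, c, rfl, hx⟩
      rw [hg.idr] at hx
      exact (Set.mem_singleton_iff.1 hx) ▸ hb
    · intro hx
      exact ⟨x, hx, hg.e, rfl, by rw [hg.idr]; rfl⟩

variable {hg}

theorem mem_mul {A B : hg.Sets} {x : H} :
    x ∈ A * B ↔ ∃ b ∈ A, ∃ c ∈ B, x ∈ hg.hmul b c := Iff.rfl

theorem mem_single {x y : H} : x ∈ hg.single y ↔ x = y := Iff.rfl

theorem mem_single_mul_single {x p q : H} :
    x ∈ hg.single p * hg.single q ↔ x ∈ hg.hmul p q := by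
  simp [mem_mul, mem_single]

theorem mem_one {x : H} : x ∈ (1 : hg.Sets) ↔ x = hg.e := Iff.rfl

theorem single_e : hg.single hg.e = 1 := rfl

theorem e_mem_hmul {p q : H} : hg.e ∈ hg.hmul p q ↔ p = hg.star q := by
  rw [hg.h3l, hg.idl]; rfl

theorem e_mem_hmul' {p q : H} : hg.e ∈ hg.hmul p q ↔ q = hg.star p := by
  rw [hg.h3r, hg.idr]; rfl

theorem star_star (p : H) : hg.star (hg.star p) = p :=
  (e_mem_hmul'.1 (e_mem_hmul.2 rfl)).symm

theorem star_e : hg.star hg.e = hg.e :=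
  (e_mem_hmul.1 (by rw [hg.idl]; rfl)).symm

theorem hmul_nonempty (p q : H) : (hg.hmul p q).Nonempty := by
  have h : p ∈ ⋃ x ∈ hg.hmul p q, hg.hmul x (hg.star q) := by
    rw [hg.assoc]
    refine Set.mem_biUnion (x := hg.e) (e_mem_hmul.2 (star_star q).symm) ?_
    rw [hg.idr]; rfl
  obtain ⟨x, hx, -⟩ := Set.mem_iUnion₂.1 h
  exact ⟨x, hx⟩

theorem listProd_nonempty (l : List (Set H)) (h : ∀ A ∈ l, A.Nonempty) :
    (hg.listProd l).Nonempty := by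
  induction l with
  | nil => exact ⟨hg.e, rfl⟩
  | cons A l ih =>
    obtain ⟨a, ha⟩ := h A (by simp)
    obtain ⟨b, hb⟩ := ih fun B hB => h B (by simp [hB])
    obtain ⟨x, hx⟩ := hg.hmul_nonempty a b
    exact ⟨x, a, ha, b, hb, hx⟩

theorem listProd_eq_prod (l : List hg.Sets) : hg.listProd l = l.prod := by
  induction l with
  | nil => rfl
  | cons A l ih =>
    rw [List.prod_cons, ← ih]; rfl

theorem spow_eq_pow (x : H) (k : ℕ) : hg.spow x k = (hg.single x) ^ k := by
  induction k with
  | zero => rfl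
  | succ k ih =>
    rw [pow_succ, ← ih]; rfl

theorem IsClosed.e_mem {C : Set H} (hC : hg.IsClosed C) : hg.e ∈ C := by
  obtain ⟨⟨x, hx⟩, h⟩ := hC
  exact h ⟨hg.star x, ⟨x, hx, rfl⟩, x, hx, e_mem_hmul.2 rfl⟩

theorem IsInvolution.star_eq {p : H} (hp : hg.IsInvolution p) : hg.star p = p := by
  obtain ⟨hne, -, h⟩ := hp
  have h1 : hg.star p ∈ ({hg.e, p} : Set H) :=
    h ⟨hg.star p, ⟨p, by simp, rfl⟩, hg.e, by simp, by rw [hg.idr]; rfl⟩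
  rcases h1 with h1 | h1
  · exact absurd (by rw [← star_star (hg := hg) p, h1, star_e]) hne
  · exact h1

theorem IsInvolution.hmul_subset {p : H} (hp : hg.IsInvolution p) :
    hg.hmul p p ⊆ {hg.e, p} := fun x hx =>
  hp.2.2 ⟨p, ⟨p, by simp, hp.star_eq⟩, p, by simp, hx⟩

theorem IsInvolution.e_mem_hmul {p : H} (hp : hg.IsInvolution p) : hg.e ∈ hg.hmul p p :=
  Hypergroup.e_mem_hmul.2 hp.star_eq.symm

theorem IsInvolution.isThick_iff {p : H} (hp : hg.IsInvolution p) :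
    hg.IsThick p ↔ p ∈ hg.hmul p p := by
  rw [IsThick, IsThin, hp.star_eq, not_iff_comm]
  constructor
  · intro h
    refine Set.Subset.antisymm (fun x hx => ?_) (Set.singleton_subset_iff.2 hp.e_mem_hmul)
    rcases hp.hmul_subset hx with rfl | rfl
    · rfl
    · exact absurd hx h
  · intro h h'
    rw [h] at h'
    exact hp.1 h'

theorem IsInvolution.gen_eq {p : H} (hp : hg.IsInvolution p) : hg.gen {p} = {hg.e, p} := by
  apply Set.Subset.antisymm
  · exact Set.sInter_subset_of_mem ⟨hp.2, by simp⟩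
  · refine Set.subset_sInter fun C hC => ?_
    rintro x (rfl | rfl)
    · exact hC.1.e_mem
    · exact hC.2 rfl

end Hypergroup

namespace EA2Data

open Hypergroup

variable (E : EA2Data H)

theorem fam_eq (i : Fin E.n) : E.fam i = {E.hg.e, E.q i} := (E.invol i).gen_eq

theorem single_q_comm (i j : Fin E.n) :
    Commute (E.hg.single (E.q i)) (E.hg.single (E.q j)) := by
  have key : ∀ i j x, E.q i ≠ E.q j → x ∈ E.hg.hmul (E.q i) (E.q j) →
      x ∈ E.hg.hmul (E.q j) (E.q i) := by
    intro i j x hij hx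
    have h1 : x ∈ E.hg.smul (E.fam i) {E.q j} :=
      ⟨E.q i, by rw [fam_eq]; simp, E.q j, rfl, hx⟩
    have hn : E.hg.smul (E.fam i) {E.q j} = E.hg.smul {E.q j} (E.fam i) :=
      (E.dp.1 i).2.2.2 (E.q j) trivial
    rw [hn, fam_eq] at h1
    obtain ⟨b, rfl, c, rfl | rfl, h1⟩ := h1
    · rw [E.hg.idr] at h1
      obtain rfl : x = E.q j := h1
      rw [E.hg.h3l, (E.invol j).star_eq] at hx
      rcases (E.invol j).hmul_subset hx with h | h
      · exact absurd h (E.invol i).1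
      · exact absurd h hij
    · exact h1
  by_cases hij : E.q i = E.q j
  · rw [hij]
  · refine Sets.ext fun x => ?_
    rw [mem_single_mul_single, mem_single_mul_single]
    exact ⟨key i j x hij, key j i x (Ne.symm hij)⟩

/-- The family with entries `q i` for `i ∈ U` and `e` for `i ∉ U`. -/
def fac (U : Finset (Fin E.n)) (i : Fin E.n) : H := if i ∈ U then E.q i else E.hg.e

variable {E} in
theorem fac_mem (U : Finset (Fin E.n)) (i : Fin E.n) : E.fac U i ∈ E.fam i := by
  rw [fam_eq, fac]; split_ifs <;> simp

variable {E} in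
theorem exists_fac {r : Fin E.n → H} (h : ∀ i, r i ∈ E.fam i) : ∃ U, r = E.fac U := by
  classical
  refine ⟨Finset.univ.filter fun i => r i = E.q i, funext fun i => ?_⟩
  have := h i
  rw [fam_eq] at this
  rcases this with h | h <;> by_cases h' : r i = E.q i <;> simp_all [fac]

theorem exists_famProd_fac (U : Finset (Fin E.n)) : ∃ x, E.hg.famProd (E.fac U) = {x} := by
  obtain ⟨x, hx⟩ : (E.hg.famProd (E.fac U)).Nonempty := by
    apply listProd_nonempty
    simp
  refine ⟨x, Set.Subset.antisymm ?_ (Set.singleton_subset_iff.2 hx)⟩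
  rw [← E.constrained x]
  exact fun y hy => ⟨_, ⟨fac_mem U, hx⟩, hy⟩

/-- The element of `H` whose support is `q '' U`. -/
noncomputable def elt (U : Finset (Fin E.n)) : H := (E.exists_famProd_fac U).choose

theorem famProd_fac (U : Finset (Fin E.n)) : E.hg.famProd (E.fac U) = {E.elt U} :=
  (E.exists_famProd_fac U).choose_spec

theorem isDecomp_iff {x : H} {r : Fin E.n → H} :
    E.hg.IsDecomp E.fam x r ↔ ∃ U, r = E.fac U ∧ x = E.elt U := by
  constructor
  · rintro ⟨h1, h2⟩
    obtain ⟨U, rfl⟩ := exists_fac h1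
    rw [famProd_fac] at h2
    exact ⟨U, rfl, h2⟩
  · rintro ⟨U, rfl, rfl⟩
    exact ⟨fac_mem U, by rw [famProd_fac]; rfl⟩

theorem elt_surjective : Function.Surjective E.elt := by
  intro x
  have hx : x ∈ E.hg.dcover E.fam x := by
    have : E.hg.dcover E.fam x = {x} := E.constrained x
    rw [this]; rfl
  obtain ⟨r, hr, -⟩ := hx
  obtain ⟨U, -, rfl⟩ := E.isDecomp_iff.1 hr
  exact ⟨U, rfl⟩

theorem single_elt_eq_list_prod (U : Finset (Fin E.n)) :
    E.hg.single (E.elt U) =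
      ((List.finRange E.n).map fun i => E.hg.single (E.fac U i)).prod :=
  (E.famProd_fac U).symm.trans (listProd_eq_prod (hg := E.hg) _)

theorem single_comm (x y : H) : Commute (E.hg.single x) (E.hg.single y) := by
  have h1 : ∀ U V i j, Commute (E.hg.single (E.fac U i)) (E.hg.single (E.fac V j)) := by
    intro U V i j
    unfold fac
    split_ifs
    · exact E.single_q_comm i j
    · exact Commute.one_right _
    · exact Commute.one_left _
    · exact Commute.one_left _
  obtain ⟨U, rfl⟩ := E.elt_surjective x
  obtain ⟨V, rfl⟩ := E.elt_surjective y
  rw [single_elt_eq_list_prod, single_elt_eq_list_prod]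
  refine Commute.list_prod_left _ _ fun a ha => Commute.list_prod_right _ _ fun b hb => ?_
  obtain ⟨i, -, rfl⟩ := List.mem_map.1 ha
  obtain ⟨j, -, rfl⟩ := List.mem_map.1 hb
  exact h1 U V i j

theorem hmul_comm (x y : H) : E.hg.hmul x y = E.hg.hmul y x := by
  ext z
  rw [← mem_single_mul_single, (E.single_comm x y).eq, mem_single_mul_single]

noncomputable instance : CommMonoid E.hg.Sets where
  mul_comm A B := Sets.ext fun x => by
    constructor
    · rintro ⟨b, hb, c, hc, h⟩
      exact ⟨c, hc, b, hb, by rwa [hmul_comm]⟩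
    · rintro ⟨b, hb, c, hc, h⟩
      exact ⟨c, hc, b, hb, by rwa [hmul_comm]⟩

theorem single_elt (U : Finset (Fin E.n)) :
    E.hg.single (E.elt U) = ∏ i, E.hg.single (E.fac U i) := by
  rw [single_elt_eq_list_prod, Fin.prod_univ_def]

theorem mem_prod {ι : Type*} (s : Finset ι) (A : ι → E.hg.Sets) (x : H) :
    x ∈ ∏ i ∈ s, A i ↔
      ∃ f : ι → H, (∀ i ∈ s, f i ∈ A i) ∧ x ∈ ∏ i ∈ s, E.hg.single (f i) := by
  classical
  induction s using Finset.induction_on generalizing x with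
  | empty => exact ⟨fun h => ⟨fun _ => x, by simp, h⟩, fun ⟨_, _, h⟩ => h⟩
  | insert a s ha ih =>
    rw [Finset.prod_insert ha, mem_mul]
    constructor
    · rintro ⟨b, hb, c, hc, hx⟩
      obtain ⟨f, hf, hc⟩ := (ih c).1 hc
      have hne : ∀ i ∈ s, i ≠ a := fun i hi h => ha (h ▸ hi)
      refine ⟨Function.update f a b, ?_, ?_⟩
      · intro i hi
        rcases Finset.mem_insert.1 hi with rfl | hi
        · simpa using hb
        · simpa [Function.update_of_ne (hne i hi)] using hf i hi
      · rw [Finset.prod_insert ha, mem_mul]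
        refine ⟨b, by simp [mem_single], c, ?_, hx⟩
        rwa [Finset.prod_congr rfl fun i hi => by rw [Function.update_of_ne (hne i hi)]]
    · rintro ⟨f, hf, hx⟩
      rw [Finset.prod_insert ha, mem_mul] at hx
      obtain ⟨b, hb, c, hc, hx⟩ := hx
      rw [mem_single] at hb
      exact ⟨b, hb ▸ hf a (by simp), c,
        (ih c).2 ⟨f, fun i hi => hf i (by simp [hi]), hc⟩, hx⟩

theorem cofactor_eq_prod (i : Fin E.n) :
    E.hg.cofactor E.fam i = ∏ j ∈ Finset.univ.erase i, E.hg.ofSet (E.fam j) := by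
  have h : (Finset.univ.erase i : Finset (Fin E.n)) =
      ((List.finRange E.n).filter fun j => decide (j ≠ i)).toFinset := by
    ext j; simp
  rw [h, List.prod_toFinset _ ((List.nodup_finRange _).filter _)]
  exact listProd_eq_prod (hg := E.hg) _

theorem fam_mul_fam (i : Fin E.n) :
    E.hg.ofSet (E.fam i) * E.hg.ofSet (E.fam i) = E.hg.ofSet (E.fam i) := by
  have h0 : E.hg.e ∈ E.fam i := by rw [fam_eq]; simp
  refine Sets.ext fun x => ⟨?_, fun hx => ⟨E.hg.e, h0, x, hx, by rw [E.hg.idl]; rfl⟩⟩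
  rintro ⟨b, hb, c, hc, hx⟩
  have hbs : b ∈ E.hg.star '' E.fam i := by
    refine ⟨b, hb, ?_⟩
    rw [fam_eq] at hb
    rcases hb with rfl | rfl
    · exact star_e
    · exact (E.invol i).star_eq
  exact (E.dp.1 i).1.2 ⟨b, hbs, c, hc, hx⟩

theorem mem_fam_of_mem_fac_mul_fac {U : Finset (Fin E.n)} {i : Fin E.n} {x : H}
    (hx : x ∈ E.hg.single (E.fac U i) * E.hg.single (E.fac U i)) : x ∈ E.fam i := by
  obtain ⟨b, rfl, c, rfl, hx⟩ := hx
  have h : x ∈ E.hg.ofSet (E.fam i) * E.hg.ofSet (E.fam i) :=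
    ⟨_, fac_mem U i, _, fac_mem U i, hx⟩
  rwa [fam_mul_fam] at h

theorem elt_mul_self (U : Finset (Fin E.n)) :
    E.hg.single (E.elt U) * E.hg.single (E.elt U) =
      ∏ i, (E.hg.single (E.fac U i) * E.hg.single (E.fac U i)) := by
  rw [single_elt, Finset.prod_mul_distrib]

theorem e_mem_fac_mul_fac (U : Finset (Fin E.n)) (i : Fin E.n) :
    E.hg.e ∈ E.hg.single (E.fac U i) * E.hg.single (E.fac U i) := by
  rw [mem_single_mul_single, fac]
  split_ifs
  · exact (E.invol i).e_mem_hmul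
  · rw [E.hg.idl]; rfl

theorem star_elt (U : Finset (Fin E.n)) : E.hg.star (E.elt U) = E.elt U := by
  refine (e_mem_hmul.1 ?_).symm
  rw [← mem_single_mul_single, elt_mul_self, mem_prod]
  exact ⟨fun _ => E.hg.e, fun i _ => E.e_mem_fac_mul_fac U i, by simp [single_e, mem_one]⟩

theorem elt_mem_cofactor {U : Finset (Fin E.n)} {i : Fin E.n} (hi : i ∉ U) :
    E.elt U ∈ E.hg.cofactor E.fam i := by
  have h : E.elt U ∈ ∏ j ∈ Finset.univ.erase i, E.hg.single (E.fac U j) := by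
    have h1 := E.single_elt U
    rw [← Finset.mul_prod_erase _ _ (Finset.mem_univ i), fac, if_neg hi, single_e,
      one_mul] at h1
    rw [← h1]; rfl
  rw [cofactor_eq_prod]
  exact (E.mem_prod _ _ _).2 ⟨_, fun j _ => fac_mem U j, h⟩

theorem cofactor_hmul {i : Fin E.n} {x y z : H} (hx : x ∈ E.hg.cofactor E.fam i)
    (hy : y ∈ E.hg.cofactor E.fam i) (hz : z ∈ E.hg.hmul x y) :
    z ∈ E.hg.cofactor E.fam i := by
  rw [cofactor_eq_prod] at *
  set A := ∏ j ∈ Finset.univ.erase i, E.hg.ofSet (E.fam j) with hA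
  have h : A * A = A :=
    Finset.prod_mul_distrib.symm.trans (Finset.prod_congr rfl fun j _ => E.fam_mul_fam j)
  have hz' : z ∈ A * A := ⟨x, hx, y, hy, hz⟩
  rwa [h] at hz'

theorem single_elt_mul_of_disjoint {U V : Finset (Fin E.n)} (h : Disjoint U V) :
    E.hg.single (E.elt U) * E.hg.single (E.elt V) = E.hg.single (E.elt (U ∪ V)) := by
  rw [single_elt, single_elt, single_elt, ← Finset.prod_mul_distrib]
  refine Finset.prod_congr rfl fun i _ => ?_
  have : i ∈ U → i ∉ V := fun hi => Finset.disjoint_left.1 h hi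
  by_cases hU : i ∈ U <;> by_cases hV : i ∈ V <;> simp_all [fac, single_e]

theorem elt_singleton (i : Fin E.n) : E.elt {i} = E.q i := by
  have h := E.single_elt {i}
  rw [Finset.prod_eq_single i (fun j _ hj => by simp [fac, hj, single_e]) (by simp)] at h
  simp only [fac, Finset.mem_singleton, if_true] at h
  rw [← mem_single, ← h]; rfl

theorem subset_of_elt_eq {U V : Finset (Fin E.n)} (h : E.elt U = E.elt V) : U ⊆ V := by
  intro i hU
  by_contra hV
  have h1 : E.elt V ∈ E.hg.hmul (E.q i) (E.elt (U.erase i)) := by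
    rw [← mem_single_mul_single, ← elt_singleton, single_elt_mul_of_disjoint _ (by simp), ← h]
    rw [mem_single, ← Finset.insert_eq, Finset.insert_erase hU]
  rw [E.hg.h3l, star_elt] at h1
  have h2 := E.cofactor_hmul (E.elt_mem_cofactor hV) (E.elt_mem_cofactor (by simp)) h1
  have h3 : E.q i ∈ E.fam i ∩ E.hg.cofactor E.fam i := ⟨by rw [fam_eq]; simp, h2⟩
  have h4 : E.fam i ∩ E.hg.cofactor E.fam i = {E.hg.e} := E.dp.2.2 i
  rw [h4] at h3
  exact (E.invol i).1 h3

theorem elt_injective : Function.Injective E.elt := fun _ _ h =>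
  (E.subset_of_elt_eq h).antisymm (E.subset_of_elt_eq h.symm)

theorem q_injective : Function.Injective E.q := fun i j h => by
  rw [← elt_singleton, ← elt_singleton] at h
  exact Finset.singleton_injective (E.elt_injective h)

theorem elt_empty : E.elt ∅ = E.hg.e := by
  have h := E.single_elt ∅
  simp only [fac, Finset.notMem_empty, if_false, single_e, Finset.prod_const_one] at h
  rw [← mem_one, ← h]; rfl

theorem support_elt (U : Finset (Fin E.n)) : E.support (E.elt U) = E.q '' U := by
  ext y
  constructor
  · rintro ⟨hy, r, hr, i, rfl⟩
    obtain ⟨V, rfl, h⟩ := E.isDecomp_iff.1 hr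
    obtain rfl := E.elt_injective h
    by_cases hi : i ∈ U
    · exact ⟨i, hi, by simp [fac, hi]⟩
    · simp [fac, hi] at hy
  · rintro ⟨i, hi, rfl⟩
    exact ⟨(E.invol i).1, _, E.isDecomp_iff.2 ⟨U, rfl, rfl⟩, i, if_pos hi⟩

theorem ple_elt {U V : Finset (Fin E.n)} : E.ple (E.elt U) (E.elt V) ↔ U ⊆ V := by
  rw [ple, support_elt, support_elt, Set.image_subset_image_iff E.q_injective, Finset.coe_subset]

theorem setOf_ple_elt (V : Finset (Fin E.n)) :
    {a | E.ple a (E.elt V)} = E.elt '' {U | U ⊆ V} := by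
  ext a
  obtain ⟨U, rfl⟩ := E.elt_surjective a
  simp [ple_elt, E.elt_injective.eq_iff]

theorem elt_mem_ThickIn {U : Finset (Fin E.n)} :
    E.elt U ∈ E.ThickIn Set.univ ↔ ∀ i ∈ U, E.hg.IsThick (E.q i) := by
  have : E.elt U = E.hg.e → U = ∅ := fun h => E.elt_injective (h.trans E.elt_empty.symm)
  simp only [ThickIn, support_elt, Set.mem_ofPred_eq, Set.mem_univ, true_and,
    Set.forall_mem_image, Finset.mem_coe]
  exact or_iff_right_of_imp fun h => by simp [this h]

theorem elt_mem_ThinIn {U : Finset (Fin E.n)} :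
    E.elt U ∈ E.ThinIn Set.univ ↔ ∀ i ∈ U, E.hg.IsThin (E.q i) := by
  have : E.elt U = E.hg.e → U = ∅ := fun h => E.elt_injective (h.trans E.elt_empty.symm)
  simp only [ThinIn, support_elt, Set.mem_ofPred_eq, Set.mem_univ, true_and,
    Set.forall_mem_image, Finset.mem_coe]
  exact or_iff_right_of_imp fun h => by simp [this h]

open Classical in
/-- The indices in `U` whose involution is thick. -/
noncomputable def thickPart (U : Finset (Fin E.n)) : Finset (Fin E.n) :=
  U.filter fun i => E.hg.IsThick (E.q i)

variable {E} in
theorem mem_thickPart {U : Finset (Fin E.n)} {i : Fin E.n} :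
    i ∈ E.thickPart U ↔ i ∈ U ∧ E.hg.IsThick (E.q i) := by
  simp [thickPart]

theorem hmul_elt_of_disjoint {U V : Finset (Fin E.n)} (h : Disjoint U V) :
    E.hg.hmul (E.elt U) (E.elt V) = {E.elt (U ∪ V)} := by
  ext x
  rw [← mem_single_mul_single, single_elt_mul_of_disjoint _ h]; rfl

theorem plus_elt (U : Finset (Fin E.n)) : E.plus (E.elt U) = E.elt (E.thickPart U) := by
  have hex : ∃ z : H × H, z.1 ∈ E.ThickIn Set.univ ∧ z.2 ∈ E.ThinIn Set.univ ∧
      E.hg.hmul z.1 z.2 = {E.elt U} := by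
    refine ⟨(E.elt (E.thickPart U), E.elt (U \ E.thickPart U)), ?_, ?_, ?_⟩
    · exact E.elt_mem_ThickIn.2 fun i hi => (mem_thickPart.1 hi).2
    · refine E.elt_mem_ThinIn.2 fun i hi => ?_
      simp only [Finset.mem_sdiff, mem_thickPart, IsThick] at hi
      tauto
    · rw [E.hmul_elt_of_disjoint Finset.disjoint_sdiff, Finset.union_sdiff_of_subset]
      exact fun i hi => (mem_thickPart.1 hi).1
  obtain ⟨h1, h2, h3⟩ := Classical.epsilon_spec hex
  change E.plus (E.elt U) ∈ _ at h1
  change E.minus (E.elt U) ∈ _ at h2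
  change E.hg.hmul (E.plus (E.elt U)) (E.minus (E.elt U)) = _ at h3
  obtain ⟨A, hA⟩ := E.elt_surjective (E.plus (E.elt U))
  obtain ⟨B, hB⟩ := E.elt_surjective (E.minus (E.elt U))
  rw [← hA, elt_mem_ThickIn] at h1
  rw [← hB, elt_mem_ThinIn] at h2
  have hAB : Disjoint A B := Finset.disjoint_left.2 fun i ha hb => h1 i ha (h2 i hb)
  rw [← hA, ← hB, E.hmul_elt_of_disjoint hAB, Set.singleton_eq_singleton_iff] at h3
  obtain rfl := E.elt_injective h3
  rw [← hA]
  congr 1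
  ext i
  rw [mem_thickPart, Finset.mem_union]
  exact ⟨fun h => ⟨Or.inl h, h1 i h⟩, fun h => h.1.resolve_right fun hb => h.2 (h2 i hb)⟩

theorem fac_mem_fac_mul_fac {U V : Finset (Fin E.n)} {i : Fin E.n} :
    E.fac V i ∈ E.hg.single (E.fac U i) * E.hg.single (E.fac U i) ↔
      (i ∈ V → i ∈ E.thickPart U) := by
  by_cases hV : i ∈ V
  · by_cases hU : i ∈ U
    · simp [mem_single_mul_single, fac, mem_thickPart, hV, hU, (E.invol i).isThick_iff]
    · simp [fac, mem_thickPart, hV, hU, single_e, mem_one, (E.invol i).1]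
  · simpa [fac, hV] using E.e_mem_fac_mul_fac U i

theorem elt_mul_self_eq (U : Finset (Fin E.n)) :
    E.hg.single (E.elt U) * E.hg.single (E.elt U) =
      (E.elt '' {V | V ⊆ E.thickPart U} : Set H) := by
  refine Sets.ext fun x => ?_
  rw [elt_mul_self, mem_prod]
  constructor
  · rintro ⟨f, hf, hx⟩
    have hfam : ∀ i, f i ∈ E.fam i := fun i =>
      E.mem_fam_of_mem_fac_mul_fac (hf i (Finset.mem_univ i))
    obtain ⟨V, rfl⟩ := exists_fac hfam
    rw [← single_elt, mem_single] at hx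
    exact ⟨V, fun i hi => E.fac_mem_fac_mul_fac.1 (hf i (Finset.mem_univ i)) hi, hx.symm⟩
  · rintro ⟨V, hV, rfl⟩
    exact ⟨E.fac V, fun i _ => E.fac_mem_fac_mul_fac.2 fun hi => hV hi,
      by rw [← single_elt]; rfl⟩

theorem isIdempotentElem_elt_mul_self (U : Finset (Fin E.n)) :
    IsIdempotentElem (E.hg.single (E.elt U) * E.hg.single (E.elt U)) := by
  rw [IsIdempotentElem, elt_mul_self, ← Finset.prod_mul_distrib]
  refine Finset.prod_congr rfl fun i _ => ?_
  set A := E.hg.single (E.fac U i) * E.hg.single (E.fac U i) with hA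
  have he : E.hg.e ∈ A := E.e_mem_fac_mul_fac U i
  refine Sets.ext fun x => ⟨fun hx => ?_, fun hx => ⟨_, he, x, hx, by rw [E.hg.idl]; rfl⟩⟩
  have hq : E.q i ∈ A ↔ i ∈ E.thickPart U := by
    have := E.fac_mem_fac_mul_fac (U := U) (V := {i}) (i := i)
    rw [← hA, fac, if_pos (by simp)] at this
    simpa using this
  by_cases h : i ∈ E.thickPart U
  · have hAf : A = E.hg.ofSet (E.fam i) := by
      refine Sets.ext fun y => ⟨fun hy => E.mem_fam_of_mem_fac_mul_fac hy, fun hy => ?_⟩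
      change y ∈ E.fam i at hy
      rw [fam_eq] at hy
      rcases hy with rfl | rfl
      · exact he
      · exact hq.2 h
    rwa [hAf, fam_mul_fam, ← hAf] at hx
  · have hA1 : A = 1 := by
      refine Sets.ext fun y => ⟨fun hy => ?_, fun hy => mem_one.1 hy ▸ he⟩
      have hy' : y ∈ E.fam i := E.mem_fam_of_mem_fac_mul_fac hy
      rw [fam_eq] at hy'
      rcases hy' with rfl | rfl
      · rfl
      · exact absurd (hq.1 hy) h
    rwa [hA1, one_mul, ← hA1] at hx

theorem spow_elt (U : Finset (Fin E.n)) (s : ℕ) :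
    E.hg.spow (E.elt U) (2 * s + 2) = E.elt '' {V | V ⊆ E.thickPart U} := by
  rw [spow_eq_pow, ← elt_mul_self_eq, show 2 * s + 2 = 2 * (s + 1) by ring, pow_mul, pow_two]
  exact (E.isIdempotentElem_elt_mul_self U).pow_succ_eq s

theorem gen_elt (U : Finset (Fin E.n)) (hU : E.thickPart U = U) :
    E.hg.gen {E.elt U} = E.elt '' {V | V ⊆ U} := by
  have hsq := E.elt_mul_self_eq U
  rw [hU] at hsq
  apply Set.Subset.antisymm
  · refine Set.sInter_subset_of_mem ⟨⟨⟨_, U, Finset.Subset.refl U, rfl⟩, ?_⟩, ?_⟩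
    · rintro x ⟨_, ⟨_, ⟨V, hV, rfl⟩, rfl⟩, _, ⟨W, hW, rfl⟩, hx⟩
      rw [star_elt] at hx
      have h := E.isIdempotentElem_elt_mul_self U
      rw [IsIdempotentElem, hsq] at h
      rw [← h]
      exact ⟨_, ⟨V, hV, rfl⟩, _, ⟨W, hW, rfl⟩, hx⟩
    · exact Set.singleton_subset_iff.2 ⟨U, Finset.Subset.refl U, rfl⟩
  · refine Set.subset_sInter fun C hC => ?_
    rw [← hsq]
    rintro x ⟨_, rfl, _, rfl, hx⟩
    have hmem : E.elt U ∈ C := hC.2 rfl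
    exact hC.1.2 ⟨_, ⟨_, hmem, E.star_elt U⟩, _, hmem, hx⟩

theorem sElem_elt (U : Finset (Fin E.n)) : E.sElem (E.elt U) = (E.thickPart U).card := by
  have h : {y ∈ E.support (E.elt U) | E.hg.IsThick y} = E.q '' (E.thickPart U) := by
    ext y
    rw [support_elt]
    constructor
    · rintro ⟨⟨i, hi, rfl⟩, hy⟩
      exact ⟨i, mem_thickPart.2 ⟨hi, hy⟩, rfl⟩
    · rintro ⟨i, hi, rfl⟩
      exact ⟨⟨i, (mem_thickPart.1 hi).1, rfl⟩, (mem_thickPart.1 hi).2⟩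
  rw [sElem, h, Set.ncard_image_of_injective _ E.q_injective, Set.ncard_coe_finset]

theorem ncard_elt_image (U : Finset (Fin E.n)) :
    (E.elt '' {V | V ⊆ U}).ncard = 2 ^ U.card := by
  have h : {V | V ⊆ U} = (U.powerset : Set (Finset (Fin E.n))) := by ext; simp
  rw [Set.ncard_image_of_injective _ E.elt_injective, h, Set.ncard_coe_finset,
    Finset.card_powerset]

end EA2Data

end HyperPaper

open HyperPaper

/-- In an elementary abelian 2-hypergroup, r^{2s+2} = {a : a ⪯ r⁺} for all
s ∈ ℕ₀; moreover if r ∈ Thick(H) then r = r⁺, ⟨r⟩ = {a : a ⪯ r}, and |⟨r⟩| = 2^{s(r)}. -/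
theorem stmt1 {H : Type*} (E : EA2Data H) (r : H) :
    (∀ s : ℕ, E.hg.spow r (2 * s + 2) = {a : H | E.ple a (E.plus r)}) ∧
    (r ∈ E.ThickIn Set.univ →
      r = E.plus r ∧ E.hg.gen {r} = {a : H | E.ple a r} ∧
        (E.hg.gen {r}).ncard = 2 ^ E.sElem r) := by
  obtain ⟨U, rfl⟩ := E.elt_surjective r
  refine ⟨fun s => by rw [E.spow_elt, E.plus_elt, E.setOf_ple_elt], fun hr => ?_⟩
  have hU : E.thickPart U = U := by
    ext i
    rw [EA2Data.mem_thickPart]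
    exact and_iff_left_of_imp (E.elt_mem_ThickIn.1 hr i)
  rw [E.plus_elt, E.gen_elt U hU, E.setOf_ple_elt, E.sElem_elt, E.ncard_elt_image, hU]
  exact ⟨rfl, rfl, rfl⟩
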